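/- With the setup above, if two finitely supported configurations x, y ∈ A^G agree on the ball B(3L,1) (x(g) = y(g) for all |g| ≤ 3L), then b(x) = b(y). Hence b factors through restriction to B(3L,1) and extends to a continuous function on A^G. -/

import Mathlib

/-- Word norm with respect to a generating set `S`. -/
noncomputable def wordNorm {G : Type*} [Group G] (S : Set G) (g : G) : ℕ :=
  sInf {n | ∃ w : List G, (∀ s ∈ w, s ∈ S) ∧ w.length = n ∧ w.prod = g}

/-- Left-invariant word metric. -/
noncomputable def wdist {G : Type*} [Group G] (S : Set G) (g h : G) : ℕ :=
  wordNorm S (g⁻¹ * h)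

/-- Two elements are connected outside the ball of radius r if some path of
unit steps joins them with all vertices of word norm > r. -/
def WConnected {G : Type*} [Group G] (S : Set G) (r : ℕ) (g g' : G) : Prop :=
  ∃ (n : ℕ) (γ : ℕ → G), γ 0 = g ∧ γ n = g' ∧
    (∀ j < n, wdist S (γ j) (γ (j + 1)) = 1) ∧
    (∀ j ≤ n, r < wordNorm S (γ j))

/-- g lies in an unbounded connected component of the Cayley graph minus the
ball of radius r. -/
def InUnbounded {G : Type*} [Group G] (S : Set G) (r : ℕ) (g : G) : Prop :=
  ∀ M : ℕ, ∃ g' : G, WConnected S r g g' ∧ M < wordNorm S g'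

/-- The norm of the support of a configuration: sup of |g| over g with x(g) ≠ 0. -/
noncomputable def suppNorm {G : Type*} [Group G] {A : Type*} (S : Set G) (a0 : A)
    (x : G → A) : ℕ :=
  sSup {n | ∃ g : G, x g ≠ a0 ∧ wordNorm S g = n}

section WordNorm

variable {G : Type*} [Group G] {S : Set G}

theorem exists_word (hsym : ∀ s ∈ S, s⁻¹ ∈ S) (hgen : Subgroup.closure S = ⊤) (g : G) :
    ∃ w : List G, (∀ s ∈ w, s ∈ S) ∧ w.prod = g := by
  have hg : g ∈ (Subgroup.closure S).toSubmonoid := by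
    rw [hgen]
    trivial
  rw [Subgroup.closure_toSubmonoid] at hg
  obtain ⟨w, hw, hprod⟩ := Submonoid.exists_list_of_mem_closure hg
  refine ⟨w, fun s hs => ?_, hprod⟩
  rcases hw s hs with h | h
  · exact h
  · simpa using hsym _ h

theorem exists_geodesic_word (hsym : ∀ s ∈ S, s⁻¹ ∈ S) (hgen : Subgroup.closure S = ⊤)
    (g : G) : ∃ w : List G, (∀ s ∈ w, s ∈ S) ∧ w.length = wordNorm S g ∧ w.prod = g := by
  obtain ⟨w, hw, hprod⟩ := exists_word hsym hgen g
  exact Nat.sInf_mem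
    (s := {n | ∃ w : List G, (∀ s ∈ w, s ∈ S) ∧ w.length = n ∧ w.prod = g})
    ⟨w.length, w, hw, rfl, hprod⟩

theorem wordNorm_prod_le {w : List G} (hw : ∀ s ∈ w, s ∈ S) :
    wordNorm S w.prod ≤ w.length :=
  Nat.sInf_le ⟨w, hw, rfl, rfl⟩

theorem wordNorm_mul_le (hsym : ∀ s ∈ S, s⁻¹ ∈ S) (hgen : Subgroup.closure S = ⊤)
    (g h : G) : wordNorm S (g * h) ≤ wordNorm S g + wordNorm S h := by
  obtain ⟨v, hv, hvl, rfl⟩ := exists_geodesic_word hsym hgen g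
  obtain ⟨w, hw, hwl, rfl⟩ := exists_geodesic_word hsym hgen h
  rw [← hvl, ← hwl, ← List.prod_append, ← List.length_append]
  refine wordNorm_prod_le fun s hs => ?_
  rcases List.mem_append.1 hs with h | h
  exacts [hv s h, hw s h]

theorem inv_reverse_mem (hsym : ∀ s ∈ S, s⁻¹ ∈ S) {w : List G} (hw : ∀ s ∈ w, s ∈ S) :
    ∀ s ∈ (w.map (·⁻¹)).reverse, s ∈ S := by
  intro s hs
  simp only [List.mem_reverse, List.mem_map] at hs
  obtain ⟨t, ht, rfl⟩ := hs
  exact hsym t (hw t ht)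

theorem wordNorm_inv_le (hsym : ∀ s ∈ S, s⁻¹ ∈ S) (hgen : Subgroup.closure S = ⊤)
    (g : G) : wordNorm S g⁻¹ ≤ wordNorm S g := by
  obtain ⟨w, hw, hwl, rfl⟩ := exists_geodesic_word hsym hgen g
  rw [← hwl, List.prod_inv_reverse]
  simpa using wordNorm_prod_le (inv_reverse_mem hsym hw)

theorem wordNorm_inv (hsym : ∀ s ∈ S, s⁻¹ ∈ S) (hgen : Subgroup.closure S = ⊤)
    (g : G) : wordNorm S g⁻¹ = wordNorm S g :=
  (wordNorm_inv_le hsym hgen g).antisymm (by simpa using wordNorm_inv_le hsym hgen g⁻¹)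

theorem mem_of_wordNorm_eq_one {g : G} (hg : wordNorm S g = 1) : g ∈ S := by
  have hne : {n | ∃ w : List G, (∀ s ∈ w, s ∈ S) ∧ w.length = n ∧ w.prod = g}.Nonempty :=
    Nat.nonempty_of_pos_sInf (by
      change 0 < wordNorm S g
      omega)
  obtain ⟨w, hw, hwl, hprod⟩ := Nat.sInf_mem hne
  change w.length = wordNorm S g at hwl
  rw [hg, List.length_eq_one_iff] at hwl
  obtain ⟨s, rfl⟩ := hwl
  simp only [List.prod_singleton] at hprod
  exact hprod ▸ hw s (by simp)

theorem exists_lt_wordNorm [Infinite G] (hfin : S.Finite) (hsym : ∀ s ∈ S, s⁻¹ ∈ S)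
    (hgen : Subgroup.closure S = ⊤) (n : ℕ) : ∃ g : G, n < wordNorm S g := by
  by_contra! hle
  have : Finite S := hfin
  have hwords : {l : List S | l.length ≤ n}.Finite := List.finite_length_le S n
  refine Set.infinite_univ (α := G)
    ((hwords.image fun l => (l.map Subtype.val).prod).subset fun g _ => ?_)
  obtain ⟨w, hw, hwl, rfl⟩ := exists_geodesic_word hsym hgen g
  lift w to List S using hw
  have hlen := hle (w.map Subtype.val).prod
  rw [← hwl, List.length_map] at hlen
  exact ⟨w, hlen, rfl⟩

/-- Every subword of a geodesic word is geodesic. -/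
theorem length_le_wordNorm_of_append (hsym : ∀ s ∈ S, s⁻¹ ∈ S)
    (hgen : Subgroup.closure S = ⊤) {a b d : List G} (hw : ∀ s ∈ a ++ b ++ d, s ∈ S)
    (hgeo : (a ++ b ++ d).length = wordNorm S (a ++ b ++ d).prod) :
    b.length ≤ wordNorm S b.prod := by
  have ha := wordNorm_prod_le (S := S) (w := a) fun s hs => hw s (by simp [hs])
  have hd := wordNorm_prod_le (S := S) (w := d) fun s hs => hw s (by simp [hs])
  have h₁ := wordNorm_mul_le hsym hgen (a.prod * b.prod) d.prod
  have h₂ := wordNorm_mul_le hsym hgen a.prod b.prod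
  simp only [List.length_append, List.prod_append] at hgeo
  omega

/-- There are words `v`, `w` of length greater than `n` leaving the identity in opposite
directions: the concatenation of `v⁻¹` and `w` is geodesic, so that the `L`-neighborhoods of
their paths meet only inside the ball of radius `3 * L`. -/
theorem exists_opposite_words [Infinite G] (hfin : S.Finite) (hsym : ∀ s ∈ S, s⁻¹ ∈ S)
    (hgen : Subgroup.closure S = ⊤) (n L : ℕ) :
    ∃ v w : List G, (∀ s ∈ v, s ∈ S) ∧ (∀ s ∈ w, s ∈ S) ∧
      n < wordNorm S v.prod ∧ n < wordNorm S w.prod ∧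
      ∀ p q : List G, p <+: v → q <+: w → ∀ k l : G, wordNorm S k ≤ L → wordNorm S l ≤ L →
        p.prod * k = q.prod * l → wordNorm S (p.prod * k) ≤ 3 * L := by
  obtain ⟨g, hg⟩ := exists_lt_wordNorm hfin hsym hgen (2 * n + 2)
  obtain ⟨u, hu, hul, rfl⟩ := exists_geodesic_word hsym hgen g
  obtain ⟨a, w, rfl, ha⟩ : ∃ a w : List G, u = a ++ w ∧ a.length = n + 1 :=
    ⟨u.take (n + 1), u.drop (n + 1), by simp, by simp; omega⟩
  have haS : ∀ s ∈ a, s ∈ S := fun s hs => hu s (by simp [hs])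
  have hwS : ∀ s ∈ w, s ∈ S := fun s hs => hu s (by simp [hs])
  have hlen : (a ++ w).length = a.length + w.length := List.length_append
  have hageo := length_le_wordNorm_of_append hsym hgen (a := []) (b := a) (d := w)
    (by simpa using hu) (by simpa using hul)
  have hwgeo := length_le_wordNorm_of_append hsym hgen (a := a) (b := w) (d := [])
    (by simpa using hu) (by simpa using hul)
  refine ⟨(a.map (·⁻¹)).reverse, w, inv_reverse_mem hsym haS, hwS, ?_, by omega, ?_⟩
  · rw [← List.prod_inv_reverse, wordNorm_inv hsym hgen]
    omega
  · rintro p q ⟨p', hp⟩ ⟨q', rfl⟩ k l hk hl hkl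
    obtain ⟨b, hb⟩ : ∃ b : List G, p = (b.map (·⁻¹)).reverse :=
      ⟨(p.map (·⁻¹)).reverse, by simp [List.map_reverse]⟩
    obtain ⟨b', hb'⟩ : ∃ b' : List G, p' = (b'.map (·⁻¹)).reverse :=
      ⟨(p'.map (·⁻¹)).reverse, by simp [List.map_reverse]⟩
    have hab : a = b' ++ b := by
      rw [hb, hb', ← List.reverse_append, ← List.map_append] at hp
      exact (List.map_injective_iff.2 inv_injective (List.reverse_injective hp)).symm
    subst hab
    have hgeo := length_le_wordNorm_of_append hsym hgen (a := b') (b := b ++ q) (d := q')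
      (by simpa using hu) (by simpa using hul)
    have hpb : p.prod = b.prod⁻¹ := by rw [hb, List.prod_inv_reverse]
    have hbq : (b ++ q).prod = k * l⁻¹ := by
      rw [List.prod_append, eq_mul_inv_iff_mul_eq, mul_assoc, ← hkl, hpb, mul_inv_cancel_left]
    have h₁ := wordNorm_mul_le hsym hgen k l⁻¹
    have h₂ := wordNorm_mul_le hsym hgen p.prod k
    rw [wordNorm_inv hsym hgen] at h₁
    have h₃ : wordNorm S p.prod ≤ b.length := by
      rw [hpb, wordNorm_inv hsym hgen]
      exact wordNorm_prod_le fun s hs => haS s (by simp [hs])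
    rw [hbq, List.length_append] at hgeo
    omega

end WordNorm

/-- The ratio of the values at `u⁻¹` of a cocycle at two configurations. -/
def cocycleRatio {G A H : Type*} [Group G] [Group H] (c : G → (G → A) → H)
    (x y : G → A) (u : G) : H :=
  (c u⁻¹ x)⁻¹ * c u⁻¹ y

section Cocycle

variable {G A H : Type*} [Group G] [Group H] {S : Set G} {c : G → (G → A) → H} {L : ℕ}

theorem cocycleRatio_mul_cocycleRatio (x y z : G → A) (u : G) :
    cocycleRatio c x y u * cocycleRatio c y z u = cocycleRatio c x z u := by
  simp [cocycleRatio, mul_assoc]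

theorem cocycleRatio_one
    (hcoc : ∀ (g h : G) (x : G → A), c (g * h) x = c g (fun k => x (h⁻¹ * k)) * c h x)
    (x y : G → A) : cocycleRatio c x y 1 = 1 := by
  have hone (x : G → A) : c 1 x = 1 := by simpa using hcoc 1 1 x
  simp [cocycleRatio, hone]

theorem cocycleRatio_mul_generator (hsym : ∀ s ∈ S, s⁻¹ ∈ S)
    (hcoc : ∀ (g h : G) (x : G → A), c (g * h) x = c g (fun k => x (h⁻¹ * k)) * c h x)
    (hL : ∀ s ∈ S, ∀ x y : G → A,
      (∀ g : G, wordNorm S g ≤ L → x g = y g) → c s x = c s y)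
    {x y : G → A} {u s : G} (hs : s ∈ S)
    (hxy : ∀ k, wordNorm S k ≤ L → x (u * k) = y (u * k)) :
    cocycleRatio c x y (u * s) = cocycleRatio c x y u := by
  have hstep := hL s⁻¹ (hsym s hs) (fun k => x (u * k)) (fun k => y (u * k)) hxy
  simp [cocycleRatio, hcoc, hstep, mul_assoc]

theorem cocycleRatio_prod_eq_one (hsym : ∀ s ∈ S, s⁻¹ ∈ S)
    (hcoc : ∀ (g h : G) (x : G → A), c (g * h) x = c g (fun k => x (h⁻¹ * k)) * c h x)
    (hL : ∀ s ∈ S, ∀ x y : G → A,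
      (∀ g : G, wordNorm S g ≤ L → x g = y g) → c s x = c s y)
    {x y : G → A} {w : List G} (hw : ∀ s ∈ w, s ∈ S)
    (hxy : ∀ p, p <+: w → ∀ k, wordNorm S k ≤ L → x (p.prod * k) = y (p.prod * k)) :
    cocycleRatio c x y w.prod = 1 := by
  induction w using List.reverseRecOn with
  | nil => simpa using cocycleRatio_one hcoc x y
  | append_singleton w s ih =>
    have hpre : w <+: w ++ [s] := List.prefix_append w [s]
    rw [List.prod_append, List.prod_singleton,
      cocycleRatio_mul_generator hsym hcoc hL (hw s (by simp)) (hxy w hpre)]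
    exact ih (fun t ht => hw t (by simp [ht])) fun p hp => hxy p (hp.trans hpre)

theorem cocycleRatio_eq_of_wConnected (hsym : ∀ s ∈ S, s⁻¹ ∈ S)
    (hgen : Subgroup.closure S = ⊤)
    (hcoc : ∀ (g h : G) (x : G → A), c (g * h) x = c g (fun k => x (h⁻¹ * k)) * c h x)
    (hL : ∀ s ∈ S, ∀ x y : G → A,
      (∀ g : G, wordNorm S g ≤ L → x g = y g) → c s x = c s y)
    {x y : G → A} {R : ℕ} (hR : ∀ g, x g ≠ y g → wordNorm S g ≤ R) {u v : G}
    (huv : WConnected S (R + L) u v) :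
    cocycleRatio c x y u = cocycleRatio c x y v := by
  obtain ⟨n, γ, rfl, rfl, hstep, hfar⟩ := huv
  suffices ∀ j ≤ n, cocycleRatio c x y (γ 0) = cocycleRatio c x y (γ j) from this n le_rfl
  intro j
  induction j with
  | zero => intro _; rfl
  | succ j ih =>
    intro hj
    rw [ih (by omega)]
    have hs : (γ j)⁻¹ * γ (j + 1) ∈ S := mem_of_wordNorm_eq_one (hstep j hj)
    rw [← cocycleRatio_mul_generator hsym hcoc hL hs, mul_inv_cancel_left]
    intro k hk
    by_contra hne
    have h₁ := hR _ hne
    have h₂ := hfar j (by omega)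
    have h₃ := wordNorm_mul_le hsym hgen (γ j * k) k⁻¹
    rw [wordNorm_inv hsym hgen, mul_inv_cancel_right] at h₃
    omega

end Cocycle

theorem wordNorm_le_suppNorm {G A : Type*} [Group G] {S : Set G} {a0 : A} {x : G → A}
    (hx : {g : G | x g ≠ a0}.Finite) {g : G} (hg : x g ≠ a0) :
    wordNorm S g ≤ suppNorm S a0 x :=
  le_csSup (hx.image (wordNorm S)).bddAbove ⟨g, hg, rfl⟩

/-- If two finitely supported configurations agree on the ball of radius 3L,
then they have the same transfer value b(x) = c(h,x)⁻¹φ(h). -/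
theorem transfer_agrees_on_ball {G : Type*} [Group G] [Infinite G]
    {A : Type*} [Finite A] (a0 : A) {H : Type*} [Group H] (S : Set G)
    (hfin : S.Finite) (hsym : ∀ s ∈ S, s⁻¹ ∈ S) (hgen : Subgroup.closure S = ⊤)
    (N : ℕ → ℕ)
    (hN : ∀ (r : ℕ) (g g' : G), N r < wordNorm S g → N r < wordNorm S g' →
      WConnected S r g g')
    (c : G → (G → A) → H)
    (hcoc : ∀ (g h : G) (x : G → A),
      c (g * h) x = c g (fun k => x (h⁻¹ * k)) * c h x)
    (L : ℕ)
    (hL : ∀ s ∈ S, ∀ x y : G → A,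
      (∀ g : G, wordNorm S g ≤ L → x g = y g) → c s x = c s y)
    (x y : G → A) (hx : {g : G | x g ≠ a0}.Finite) (hy : {g : G | y g ≠ a0}.Finite)
    (hagree : ∀ g : G, wordNorm S g ≤ 3 * L → x g = y g)
    (h h' : G)
    (hh : N (suppNorm S a0 x + L) < wordNorm S h)
    (hh' : N (suppNorm S a0 y + L) < wordNorm S h') :
    (c h x)⁻¹ * c h (fun _ => a0) = (c h' y)⁻¹ * c h' (fun _ => a0) := by
  classical
  set R := max (suppNorm S a0 x) (suppNorm S a0 y)
  have hxsupp : ∀ g, x g ≠ a0 → wordNorm S g ≤ suppNorm S a0 x :=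
    fun g => wordNorm_le_suppNorm hx
  have hysupp : ∀ g, y g ≠ a0 → wordNorm S g ≤ suppNorm S a0 y :=
    fun g => wordNorm_le_suppNorm hy
  have hxyR : ∀ g, x g ≠ y g → wordNorm S g ≤ R := by
    intro g hg
    by_cases hxg : x g = a0
    · exact (hysupp g (by rw [← hxg]; exact hg.symm)).trans (le_max_right _ _)
    · exact (hxsupp g hxg).trans (le_max_left _ _)
  obtain ⟨v, w, hv, hw, hvn, hwn, hvw⟩ := exists_opposite_words hfin hsym hgen (N (R + L)) L
  obtain ⟨u, hu⟩ := exists_lt_wordNorm hfin hsym hgen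
    (max (N (R + L)) (max (N (suppNorm S a0 x + L)) (N (suppNorm S a0 y + L))))
  simp only [max_lt_iff] at hu
  obtain ⟨huR, hux, huy⟩ := hu
  let z : G → A := fun g =>
    if ∃ p, p <+: v ∧ ∃ k, wordNorm S k ≤ L ∧ g = p.prod * k then x g else y g
  have hxz : cocycleRatio c x z u = 1 := by
    rw [← cocycleRatio_prod_eq_one hsym hcoc hL (x := x) (y := z) hv
      fun p hp k hk => (if_pos ⟨p, hp, k, hk, rfl⟩).symm]
    refine cocycleRatio_eq_of_wConnected hsym hgen hcoc hL (fun g hg => hxyR g ?_)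
      (hN _ _ _ huR hvn)
    intro hxy
    simp [z, hxy] at hg
  have hzy : cocycleRatio c z y u = 1 := by
    rw [← cocycleRatio_prod_eq_one hsym hcoc hL (x := z) (y := y) hw ?_]
    · refine cocycleRatio_eq_of_wConnected hsym hgen hcoc hL (fun g hg => hxyR g ?_)
        (hN _ _ _ huR hwn)
      intro hxy
      simp [z, hxy] at hg
    · intro q hq l hl
      by_cases hmem : ∃ p, p <+: v ∧ ∃ k, wordNorm S k ≤ L ∧ q.prod * l = p.prod * k
      · refine (if_pos hmem).trans (hagree _ ?_)
        obtain ⟨p, hp, k, hk, hkl⟩ := hmem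
        rw [hkl]
        exact hvw p q hp hq k l hk hl hkl.symm
      · exact if_neg hmem
  have hxfar : cocycleRatio c x (fun _ => a0) h⁻¹ = cocycleRatio c x (fun _ => a0) u :=
    cocycleRatio_eq_of_wConnected hsym hgen hcoc hL hxsupp
      (hN _ _ _ (by rwa [wordNorm_inv hsym hgen]) hux)
  have hyfar : cocycleRatio c y (fun _ => a0) h'⁻¹ = cocycleRatio c y (fun _ => a0) u :=
    cocycleRatio_eq_of_wConnected hsym hgen hcoc hL hysupp
      (hN _ _ _ (by rwa [wordNorm_inv hsym hgen]) huy)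
  have hfinal : cocycleRatio c x (fun _ => a0) h⁻¹ = cocycleRatio c y (fun _ => a0) h'⁻¹ := by
    rw [hxfar, hyfar, ← cocycleRatio_mul_cocycleRatio x z, ← cocycleRatio_mul_cocycleRatio z y,
      hxz, hzy, one_mul, one_mul]
  simpa [cocycleRatio] using hfinal
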